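/- Let n ≥ 1, 0 < β < 1, 0 < α < n with α + β < n, 0 < t < ∞, 1 < p < r < ∞ and 1 < q < s < ∞ satisfy (α+β)/n = 1/p − 1/r = 1/q − 1/s. Let Ω be homogeneous of degree zero, have mean value zero on S^{n−1}, and be a Lipschitz function. If b ∈ Lip_β(ℝ^n), then the commutator [b, T_{Ω,α}] is bounded from (E_p^q)_t(ℝ^n) to (E_r^s)_t(ℝ^n); more precisely there is a constant C, independent of b, f and t, such that ‖[b, T_{Ω,α}]f‖_{(E_r^s)_t} ≤ C ‖b‖_{Lip_β} ‖f‖_{(E_p^q)_t} for all f ∈ (E_p^q)_t(ℝ^n). -/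

import Mathlib

open MeasureTheory ENNReal Metric

noncomputable section

/-- The (closed) cube centered at `x` with side length `r`. -/
def cube {n : ℕ} (x : EuclideanSpace ℝ (Fin n)) (r : ℝ) : Set (EuclideanSpace ℝ (Fin n)) :=
  {y | ∀ i, |y i - x i| ≤ r / 2}

/-- The average `f_Q = |Q|⁻¹ ∫_Q f` of `f` over a set `Q`. -/
def setAvg {n : ℕ} (Q : Set (EuclideanSpace ℝ (Fin n))) (f : EuclideanSpace ℝ (Fin n) → ℝ) : ℝ :=
  (volume Q).toReal⁻¹ * ∫ y in Q, f y

/-- Slice norm of an `ℝ≥0∞`-valued function. -/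
def sliceNormE {n : ℕ} (p q t : ℝ) (g : EuclideanSpace ℝ (Fin n) → ℝ≥0∞) : ℝ≥0∞ :=
  (∫⁻ x, ((volume (cube x t))⁻¹ * ∫⁻ y in cube x t, g y ^ p) ^ (q / p)) ^ (1 / q)

/-- The slice space norm `‖f‖_{(E_p^q)_t}`. -/
def sliceNorm {n : ℕ} (p q t : ℝ) (f : EuclideanSpace ℝ (Fin n) → ℝ) : ℝ≥0∞ :=
  sliceNormE p q t fun y => ENNReal.ofReal |f y|

/-- Membership in the slice space `(E_p^q)_t(ℝⁿ)`. -/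
def MemSlice {n : ℕ} (p q t : ℝ) (f : EuclideanSpace ℝ (Fin n) → ℝ) : Prop :=
  Measurable f ∧ sliceNorm p q t f ≠ ∞

/-- The BMO seminorm, as a supremum over all cubes. -/
def bmoNorm {n : ℕ} (b : EuclideanSpace ℝ (Fin n) → ℝ) : ℝ≥0∞ :=
  ⨆ (x : EuclideanSpace ℝ (Fin n)) (r : ℝ) (_ : 0 < r),
    (volume (cube x r))⁻¹ * ∫⁻ y in cube x r, ENNReal.ofReal |b y - setAvg (cube x r) b|

/-- Membership in `BMO(ℝⁿ)`. -/
def MemBMO {n : ℕ} (b : EuclideanSpace ℝ (Fin n) → ℝ) : Prop :=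
  LocallyIntegrable b volume ∧ bmoNorm b ≠ ∞

/-- `Ω` is homogeneous of degree zero. -/
def HomogZero {n : ℕ} (Ω : EuclideanSpace ℝ (Fin n) → ℝ) : Prop :=
  ∀ lam : ℝ, 0 < lam → ∀ x : EuclideanSpace ℝ (Fin n), x ≠ 0 → Ω (lam • x) = Ω x

/-- `Ω` has mean value zero on the unit sphere. -/
def MeanZeroOnSphere {n : ℕ} (Ω : EuclideanSpace ℝ (Fin n) → ℝ) : Prop :=
  ∫ x : sphere (0 : EuclideanSpace ℝ (Fin n)) 1, Ω x
    ∂((volume : Measure (EuclideanSpace ℝ (Fin n))).toSphere) = 0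

/-- The fractional integral operator with rough kernel,
`T_{Ω,α} f (x) = ∫ Ω(x-y) |x-y|^{α-n} f(y) dy`. -/
def fracInt {n : ℕ} (Ω : EuclideanSpace ℝ (Fin n) → ℝ) (α : ℝ)
    (f : EuclideanSpace ℝ (Fin n) → ℝ) (x : EuclideanSpace ℝ (Fin n)) : ℝ :=
  ∫ y, Ω (x - y) * ‖x - y‖ ^ (α - n) * f y

/-- The commutator `[b, T_{Ω,α}] f = b ⬝ T_{Ω,α} f - T_{Ω,α}(b f)`. -/
def commutatorOp {n : ℕ} (Ω : EuclideanSpace ℝ (Fin n) → ℝ) (α : ℝ)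
    (b f : EuclideanSpace ℝ (Fin n) → ℝ) : EuclideanSpace ℝ (Fin n) → ℝ :=
  fun x => b x * fracInt Ω α f x - fracInt Ω α (fun y => b y * f y) x

/-- The fractional maximal operator `M_γ` (over cubes); `γ = 0` gives the
Hardy–Littlewood maximal operator. -/
def fracMax {n : ℕ} (γ : ℝ) (f : EuclideanSpace ℝ (Fin n) → ℝ)
    (x : EuclideanSpace ℝ (Fin n)) : ℝ≥0∞ :=
  ⨆ (z : EuclideanSpace ℝ (Fin n)) (r : ℝ) (_ : 0 < r) (_ : x ∈ cube z r),
    volume (cube z r) ^ (γ / n - 1) * ∫⁻ y in cube z r, ENNReal.ofReal |f y|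

/-- The Fefferman–Stein sharp maximal operator `M^♯`. -/
def sharpMax {n : ℕ} (f : EuclideanSpace ℝ (Fin n) → ℝ)
    (x : EuclideanSpace ℝ (Fin n)) : ℝ≥0∞ :=
  ⨆ (z : EuclideanSpace ℝ (Fin n)) (r : ℝ) (_ : 0 < r) (_ : x ∈ cube z r),
    (volume (cube z r))⁻¹ * ∫⁻ y in cube z r, ENNReal.ofReal |f y - setAvg (cube z r) f|

/-- The `L^p` norm. -/
def lpNorm {n : ℕ} (p : ℝ) (f : EuclideanSpace ℝ (Fin n) → ℝ) : ℝ≥0∞ :=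
  (∫⁻ x, ENNReal.ofReal |f x| ^ p) ^ (1 / p)

/-- The set of admissible Hölder–Lipschitz constants of order `β` for `b`. -/
def LipConstSet {n : ℕ} (β : ℝ) (b : EuclideanSpace ℝ (Fin n) → ℝ) : Set ℝ :=
  {C : ℝ | ∀ x y, |b x - b y| ≤ C * dist x y ^ β}

/-- Membership in the Lipschitz space `Lip_β(ℝⁿ)`. -/
def MemLip {n : ℕ} (β : ℝ) (b : EuclideanSpace ℝ (Fin n) → ℝ) : Prop :=
  (LipConstSet β b).Nonempty

/-- The `Lip_β` norm: the least admissible constant. -/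
def lipNorm {n : ℕ} (β : ℝ) (b : EuclideanSpace ℝ (Fin n) → ℝ) : ℝ :=
  sInf (LipConstSet β b)

lemma lintegral_indicator_ofReal_lt_rpow {r : ℝ} (hr : 0 < r) (u : ℝ≥0∞) :
    ∫⁻ τ in Set.Ioi (0 : ℝ),
      {τ : ℝ | ENNReal.ofReal τ < u}.indicator (fun τ => ENNReal.ofReal τ ^ (r - 1)) τ
      = u ^ r / ENNReal.ofReal r := by
  have key : ∀ τ ∈ Set.Ioi (0 : ℝ), ENNReal.ofReal τ ^ (r - 1) = ENNReal.ofReal (τ ^ (r - 1)) :=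
    fun τ hτ => ENNReal.ofReal_rpow_of_pos hτ
  induction u using ENNReal.recTopCoe with
  | top =>
    have h1 : {τ : ℝ | ENNReal.ofReal τ < ⊤} = Set.univ := by ext; simp
    rw [h1, Set.indicator_univ, setLIntegral_congr_fun measurableSet_Ioi key,
      ENNReal.top_rpow_of_pos hr, ENNReal.top_div_of_ne_top ENNReal.ofReal_ne_top]
    by_contra hne
    refine not_integrableOn_Ioi_rpow (r - 1) ⟨by fun_prop, ?_⟩
    rw [hasFiniteIntegral_iff_ofReal]
    · exact lt_top_iff_ne_top.2 hne
    · exact (ae_restrict_iff' measurableSet_Ioi).2 (.of_forall fun τ hτ =>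
        Real.rpow_nonneg (le_of_lt hτ) _)
  | coe c =>
    have h1 : Set.Ioi (0 : ℝ) ∩ {τ : ℝ | ENNReal.ofReal τ < (c : ℝ≥0∞)} = Set.Ioo 0 (c : ℝ) := by
      ext τ
      simp only [Set.mem_inter_iff, Set.mem_Ioi, Set.mem_ofPred_eq, Set.mem_Ioo]
      refine and_congr_right fun hτ => ?_
      rw [← ENNReal.ofReal_coe_nnreal, ENNReal.ofReal_lt_ofReal_iff']
      exact ⟨fun h => h.1, fun h => ⟨h, hτ.trans h⟩⟩
    rw [setLIntegral_indicator (measurableSet_lt (by fun_prop) (by fun_prop)), Set.inter_comm, h1,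
      setLIntegral_congr_fun measurableSet_Ioo (fun τ hτ => key τ hτ.1),
      setLIntegral_congr Ioo_ae_eq_Ioc]
    have hi : IntegrableOn (fun τ : ℝ => τ ^ (r - 1)) (Set.Ioc 0 (c : ℝ)) :=
      (intervalIntegral.intervalIntegrable_rpow' (by linarith)).1
    rw [← ofReal_integral_eq_lintegral_ofReal hi
      ((ae_restrict_iff' measurableSet_Ioc).2 (.of_forall fun τ hτ =>
        Real.rpow_nonneg hτ.1.le _)), ← intervalIntegral.integral_of_le c.coe_nonneg,
      integral_rpow (Or.inl (by linarith)), sub_add_cancel, Real.zero_rpow hr.ne', sub_zero,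
      ENNReal.ofReal_div_of_pos hr, ← ENNReal.ofReal_rpow_of_nonneg c.coe_nonneg hr.le,
      ENNReal.ofReal_coe_nnreal]

section Riesz

open Module

variable {E : Type*} [NormedAddCommGroup E] [NormedSpace ℝ E] [FiniteDimensional ℝ E]
  [MeasurableSpace E] [BorelSpace E]

lemma lintegral_indicator_norm_rpow_scale (μ : Measure E) [μ.IsAddHaarMeasure] {S T : Set ℝ}
    (hS : MeasurableSet S) (a : ℝ) {ρ : ℝ} (hρ : 0 < ρ) (hT : ∀ y, ρ * y ∈ T ↔ y ∈ S) :
    ∫⁻ x : E in {x | ‖x‖ ∈ T}, ‖x‖ₑ ^ a ∂μ =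
      ENNReal.ofReal ρ ^ (a + finrank ℝ E) * ∫⁻ x : E in {x | ‖x‖ ∈ S}, ‖x‖ₑ ^ a ∂μ := by
  have h0 : ENNReal.ofReal ρ ≠ 0 := by simpa using hρ
  have hTm : MeasurableSet T := by
    have : T = (fun y => ρ⁻¹ * y) ⁻¹' S := by
      ext y; rw [Set.mem_preimage, ← hT]; field_simp
    rw [this]; exact hS.preimage (by fun_prop)
  have hTm' : MeasurableSet {x : E | ‖x‖ ∈ T} := hTm.preimage measurable_norm
  have hSm' : MeasurableSet {x : E | ‖x‖ ∈ S} := hS.preimage measurable_norm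
  have hmap := Measure.map_addHaar_smul μ (inv_ne_zero hρ.ne')
  have hpos : |((ρ⁻¹) ^ finrank ℝ E)⁻¹| = ρ ^ finrank ℝ E := by
    rw [inv_pow, inv_inv, abs_of_pos (by positivity)]
  rw [hpos] at hmap
  have h2 : ENNReal.ofReal (ρ ^ finrank ℝ E) = ENNReal.ofReal ρ ^ (finrank ℝ E : ℝ) := by
    rw [ENNReal.ofReal_pow hρ.le, ENNReal.rpow_natCast]
  rw [← lintegral_indicator hTm', ← lintegral_indicator hSm', ENNReal.rpow_add _ _ h0 (by simp),
    ← h2, mul_assoc, ← smul_eq_mul (ENNReal.ofReal (ρ ^ finrank ℝ E)), ← lintegral_smul_measure,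
    ← hmap, lintegral_map ((by fun_prop : Measurable fun x : E => ‖x‖ₑ ^ a).indicator hSm')
      (by fun_prop), ← lintegral_const_mul' _ _ (ENNReal.rpow_ne_top_of_ne_zero h0 (by simp))]
  refine lintegral_congr fun x => ?_
  have h3 : x = ρ • ρ⁻¹ • x := by rw [smul_smul, mul_inv_cancel₀ hρ.ne', one_smul]
  have h4 : ‖x‖ = ρ * ‖ρ⁻¹ • x‖ := by
    conv_lhs => rw [h3]
    rw [norm_smul, Real.norm_of_nonneg hρ.le]
  have h5 : ‖x‖ₑ = ENNReal.ofReal ρ * ‖ρ⁻¹ • x‖ₑ := by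
    conv_lhs => rw [h3]
    rw [enorm_smul, Real.enorm_of_nonneg hρ.le]
  by_cases hx : ‖x‖ ∈ T
  · have hx' : ‖ρ⁻¹ • x‖ ∈ S := by rwa [h4, hT] at hx
    rw [Set.indicator_of_mem (by exact hx), Set.indicator_of_mem (by exact hx'), h5,
      ENNReal.mul_rpow_of_ne_top (by simp) (by simp)]
  · have hx' : ‖ρ⁻¹ • x‖ ∉ S := by rwa [h4, hT] at hx
    rw [Set.indicator_of_notMem (by exact hx), Set.indicator_of_notMem (by exact hx'), mul_zero]

lemma lintegral_lintegral_convolution (μ : Measure E) [μ.IsAddHaarMeasure] {k g : E → ℝ≥0∞}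
    (hk : Measurable k) (hg : Measurable g) :
    ∫⁻ x, ∫⁻ y, k (x - y) * g y ∂μ ∂μ = (∫⁻ z, k z ∂μ) * ∫⁻ y, g y ∂μ := by
  rw [lintegral_lintegral_swap (by fun_prop)]
  have h : ∀ y, ∫⁻ x, k (x - y) * g y ∂μ = (∫⁻ z, k z ∂μ) * g y := fun y => by
    rw [lintegral_mul_const _ (by fun_prop), lintegral_sub_right_eq_self k y]
  simp_rw [h]
  exact lintegral_const_mul _ hg

/-- The Riesz potential of order `γ` of a nonnegative function (without normalizing constant). -/
noncomputable def rieszPotential (μ : Measure E) (γ : ℝ) (g : E → ℝ≥0∞) (x : E) : ℝ≥0∞ :=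
  ∫⁻ y, ‖x - y‖ₑ ^ (γ - finrank ℝ E) * g y ∂μ

lemma measurable_rieszPotential (μ : Measure E) [SFinite μ] (γ : ℝ) {g : E → ℝ≥0∞}
    (hg : Measurable g) : Measurable (rieszPotential μ γ g) := by
  unfold rieszPotential
  exact Measurable.lintegral_prod_right' (f := fun z : E × E =>
    ‖z.1 - z.2‖ₑ ^ (γ - finrank ℝ E) * g z.2) (by fun_prop)

variable [Nontrivial E]

lemma lintegral_enorm_rpow_lt_top_of_integrableOn (μ : Measure E) [μ.IsAddHaarMeasure] {S : Set ℝ}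
    (hS : MeasurableSet S) (a : ℝ)
    (h : IntegrableOn (fun y : ℝ => y ^ (a + finrank ℝ E - 1)) (Set.Ioi 0 ∩ S)) :
    ∫⁻ x : E in {x | ‖x‖ ∈ S}, ‖x‖ₑ ^ a ∂μ < ⊤ := by
  have hSm' : MeasurableSet {x : E | ‖x‖ ∈ S} := hS.preimage measurable_norm
  have h1 : Integrable (fun x : E => S.indicator (fun y : ℝ => y ^ a) ‖x‖) μ := by
    rw [integrable_fun_norm_addHaar]
    rw [Set.inter_comm, IntegrableOn, ← Measure.restrict_restrict hS, ← IntegrableOn,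
      ← integrable_indicator_iff hS] at h
    refine (integrable_congr ((ae_restrict_iff' measurableSet_Ioi).2
      (.of_forall fun y hy => ?_))).1 h
    have hy : 0 < y := hy
    by_cases hyS : y ∈ S
    · simp only [Set.indicator_of_mem hyS, smul_eq_mul]
      rw [← Real.rpow_natCast, ← Real.rpow_add hy, Nat.cast_sub finrank_pos]
      congr 1
      push_cast
      ring
    · simp [Set.indicator_of_notMem hyS]
  have h2 := h1.2
  rw [hasFiniteIntegral_iff_enorm] at h2
  refine lt_of_le_of_lt ?_ h2
  rw [← lintegral_indicator hSm']
  refine lintegral_mono_ae ?_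
  have : ∀ᵐ x : E ∂μ, x ≠ 0 := by simp [ae_iff, measure_singleton]
  filter_upwards [this] with x hx
  by_cases hxS : ‖x‖ ∈ S
  · rw [Set.indicator_of_mem (by exact hxS), Set.indicator_of_mem hxS,
      Real.enorm_of_nonneg (by positivity), ← ENNReal.ofReal_rpow_of_pos (by positivity),
      ofReal_norm]
  · rw [Set.indicator_of_notMem (by exact hxS)]; simp

lemma lintegral_enorm_rpow_lt (μ : Measure E) [μ.IsAddHaarMeasure] {a : ℝ}
    (ha : -(finrank ℝ E : ℝ) < a) : ∃ A : ℝ≥0∞, A ≠ ⊤ ∧ ∀ ρ : ℝ, 0 < ρ →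
      ∫⁻ x : E in {x | ‖x‖ < ρ}, ‖x‖ₑ ^ a ∂μ = A * ENNReal.ofReal ρ ^ (a + finrank ℝ E) := by
  refine ⟨∫⁻ x : E in {x | ‖x‖ ∈ Set.Iio 1}, ‖x‖ₑ ^ a ∂μ,
    (lintegral_enorm_rpow_lt_top_of_integrableOn μ measurableSet_Iio a ?_).ne, fun ρ hρ => ?_⟩
  · rw [Set.Ioi_inter_Iio]
    exact (intervalIntegral.integrableOn_Ioo_rpow_iff zero_lt_one).2 (by linarith)
  · rw [mul_comm]
    exact lintegral_indicator_norm_rpow_scale μ (T := Set.Iio ρ) measurableSet_Iio a hρ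
      (fun y => by simp [hρ])

lemma lintegral_enorm_rpow_ge (μ : Measure E) [μ.IsAddHaarMeasure] {a : ℝ}
    (ha : a < -(finrank ℝ E : ℝ)) : ∃ A : ℝ≥0∞, A ≠ ⊤ ∧ ∀ ρ : ℝ, 0 < ρ →
      ∫⁻ x : E in {x | ρ ≤ ‖x‖}, ‖x‖ₑ ^ a ∂μ = A * ENNReal.ofReal ρ ^ (a + finrank ℝ E) := by
  refine ⟨∫⁻ x : E in {x | ‖x‖ ∈ Set.Ici 1}, ‖x‖ₑ ^ a ∂μ,
    (lintegral_enorm_rpow_lt_top_of_integrableOn μ measurableSet_Ici a ?_).ne, fun ρ hρ => ?_⟩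
  · exact ((integrableOn_Ici_iff_integrableOn_Ioi).2
      (integrableOn_Ioi_rpow_of_lt (by linarith) zero_lt_one)).mono_set Set.inter_subset_right
  · rw [mul_comm]
    exact lintegral_indicator_norm_rpow_scale μ (T := Set.Ici ρ) measurableSet_Ici a hρ
      (fun y => by simp [hρ])

/-- Splitting of the Riesz potential at radius `ρ` and of the function at height `h`. -/
lemma exists_rieszPotential_le (μ : Measure E) [μ.IsAddHaarMeasure] {γ p : ℝ} (hγ : 0 < γ)
    (hp : 1 < p) (hγp : γ < finrank ℝ E / p) :
    ∃ A B : ℝ≥0∞, A ≠ ⊤ ∧ B ≠ ⊤ ∧ ∀ f : E → ℝ≥0∞, Measurable f → ∫⁻ y, f y ^ p ∂μ ≤ 1 →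
      ∀ (ρ : ℝ) (h : ℝ≥0∞), 0 < ρ → ∃ S : E → ℝ≥0∞, Measurable S ∧
        ∫⁻ x, S x ∂μ = A * ENNReal.ofReal ρ ^ γ * ∫⁻ y in {y | h < f y}, f y ∂μ ∧
        ∀ x, rieszPotential μ γ f x ≤ B * ENNReal.ofReal ρ ^ (γ - finrank ℝ E / p)
          + A * ENNReal.ofReal ρ ^ γ * h + S x := by
  set d : ℝ := (finrank ℝ E : ℝ) with hd
  have hd0 : 0 < d := by rw [hd]; exact_mod_cast finrank_pos
  have hp0 : 0 < p := by linarith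
  obtain ⟨p', hpp'⟩ : ∃ p', p.HolderConjugate p' := ⟨_, Real.HolderConjugate.conjExponent hp⟩
  have hp'0 : 0 < p' := hpp'.symm.pos
  have hp' : 1 / p' = 1 - 1 / p := by
    have := hpp'.inv_add_inv_eq_one
    simp only [one_div]; linarith
  have hexp : ((γ - d) * p' + d) * (1 / p') = γ - d / p := by
    have : ((γ - d) * p' + d) * (1 / p') = (γ - d) + d * (1 / p') := by field_simp
    rw [this, hp']; ring
  have hneg : (γ - d) * p' < -d := by
    have h1 : ((γ - d) * p' + d) * (1 / p') < 0 := by rw [hexp]; linarith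
    by_contra! hc
    exact h1.not_ge (mul_nonneg (by linarith) (by positivity))
  obtain ⟨A, hA, hA'⟩ := lintegral_enorm_rpow_lt μ (a := γ - d) (by linarith)
  obtain ⟨A', hA2, hA2'⟩ := lintegral_enorm_rpow_ge μ (a := (γ - d) * p') hneg
  refine ⟨A, A' ^ (1 / p'), hA, ENNReal.rpow_ne_top_of_nonneg (by positivity) hA2, ?_⟩
  intro f hf hf1 ρ h hρ
  have hmn : MeasurableSet {z : E | ‖z‖ < ρ} := measurableSet_lt (by fun_prop) (by fun_prop)
  have hmf : MeasurableSet {z : E | ρ ≤ ‖z‖} := measurableSet_le (by fun_prop) (by fun_prop)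
  have hmh : MeasurableSet {y | h < f y} := measurableSet_lt (by fun_prop) hf
  set kn : E → ℝ≥0∞ := {z : E | ‖z‖ < ρ}.indicator (fun z => ‖z‖ₑ ^ (γ - d)) with hkn
  set kf : E → ℝ≥0∞ := {z : E | ρ ≤ ‖z‖}.indicator (fun z => ‖z‖ₑ ^ (γ - d)) with hkf
  have hknm : Measurable kn := (by fun_prop : Measurable fun z : E => ‖z‖ₑ ^ (γ - d)).indicator hmn
  have hkfm : Measurable kf := (by fun_prop : Measurable fun z : E => ‖z‖ₑ ^ (γ - d)).indicator hmf
  have hIn : ∫⁻ z, kn z ∂μ = A * ENNReal.ofReal ρ ^ γ := by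
    rw [hkn, lintegral_indicator hmn, hA' ρ hρ, ← hd, sub_add_cancel]
  have hfi : Measurable ({y | h < f y}.indicator f) := hf.indicator hmh
  have hIf : ∫⁻ z, kf z ^ p' ∂μ = A' * ENNReal.ofReal ρ ^ ((γ - d) * p' + d) := by
    rw [hd, ← hA2' ρ hρ, ← lintegral_indicator hmf]
    refine lintegral_congr fun z => ?_
    by_cases hz : ρ ≤ ‖z‖
    · rw [hkf, Set.indicator_of_mem (by exact hz), Set.indicator_of_mem (by exact hz),
        ENNReal.rpow_mul]
    · rw [hkf, Set.indicator_of_notMem (by exact hz), Set.indicator_of_notMem (by exact hz),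
        ENNReal.zero_rpow_of_pos hp'0]
  refine ⟨fun x => ∫⁻ y, kn (x - y) * {y | h < f y}.indicator f y ∂μ,
    Measurable.lintegral_prod_right' (f := fun z : E × E =>
      kn (z.1 - z.2) * {y | h < f y}.indicator f z.2) (by fun_prop), ?_, fun x => ?_⟩
  · rw [lintegral_lintegral_convolution μ hknm hfi, hIn, lintegral_indicator hmh]
  calc rieszPotential μ γ f x
      ≤ ∫⁻ y, (kf (x - y) * f y + kn (x - y) * h
          + kn (x - y) * {y | h < f y}.indicator f y) ∂μ := by
        refine lintegral_mono fun y => ?_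
        rw [← hd]
        by_cases hz : ρ ≤ ‖x - y‖
        · rw [add_assoc, hkf, Set.indicator_of_mem (by exact hz)]
          exact le_self_add
        · have hz' : ‖x - y‖ < ρ := not_le.1 hz
          rw [add_assoc, hkn, Set.indicator_of_mem (by exact hz'), ← mul_add]
          refine le_add_left (mul_le_mul_right ?_ _)
          by_cases hy : h < f y
          · rw [Set.indicator_of_mem (by exact hy)]; exact le_add_self
          · exact (not_lt.1 hy).trans le_self_add
    _ = ∫⁻ y, kf (x - y) * f y ∂μ + ∫⁻ y, kn (x - y) * h ∂μ
          + ∫⁻ y, kn (x - y) * {y | h < f y}.indicator f y ∂μ := by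
        rw [lintegral_add_left (by fun_prop), lintegral_add_left (by fun_prop)]
    _ ≤ _ := by
        gcongr
        · have := ENNReal.lintegral_mul_le_Lp_mul_Lq μ hpp'.symm
            (f := fun y => kf (x - y)) (g := f) (by fun_prop) (by fun_prop)
          refine this.trans ?_
          rw [lintegral_sub_left_eq_self (fun z => kf z ^ p') x, hIf,
            ENNReal.mul_rpow_of_nonneg _ _ (by positivity), ← ENNReal.rpow_mul, hexp]
          refine mul_le_of_le_one_right' ?_
          exact ENNReal.rpow_le_one hf1 (by positivity)
        · rw [lintegral_mul_const _ (by fun_prop), lintegral_sub_left_eq_self kn x, hIn]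

lemma exists_lintegral_rieszPotential_rpow_le_of_le_one (μ : Measure E) [μ.IsAddHaarMeasure]
    {γ p r : ℝ} (hγ : 0 < γ) (hp : 1 < p) (hr : 0 < r)
    (h : γ / finrank ℝ E = 1 / p - 1 / r) :
    ∃ C : ℝ≥0∞, C ≠ ⊤ ∧ ∀ f : E → ℝ≥0∞, Measurable f → ∫⁻ y, f y ^ p ∂μ ≤ 1 →
      ∫⁻ x, rieszPotential μ γ f x ^ r ∂μ ≤ C := by
  have hp0 : 0 < p := by linarith
  have hd0 : (0 : ℝ) < finrank ℝ E := by exact_mod_cast finrank_pos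
  have hγp : γ < finrank ℝ E / p := by
    have h1 : γ / finrank ℝ E < 1 / p := by rw [h]; linarith [one_div_pos.2 hr]
    rw [div_lt_iff₀ hd0] at h1
    rw [div_eq_mul_one_div]; linarith
  have hrp : 0 < r - r / p := by
    have := div_lt_self hr hp
    linarith
  obtain ⟨A, B, hA, hB, hAB⟩ := exists_rieszPotential_le μ hγ hp hγp
  set d : ℝ := (finrank ℝ E : ℝ) with hd
  have e1 : (-r / d) * (γ - d / p) = 1 := by
    have : (-r / d) * (γ - d / p) = -r * (γ / d) + r / p := by field_simp; ring
    rw [this, h]; field_simp; ring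
  have e2 : (-r / d) * γ = 1 - r / p := by
    have : (-r / d) * γ = -r * (γ / d) := by field_simp
    rw [this, h]; field_simp; ring
  set M : ℝ≥0∞ := B + A + 1 with hM
  have hM0 : M ≠ 0 := by simp [hM]
  have hMt : M ≠ ⊤ := by simp [hM, hA, hB]
  refine ⟨M ^ r * (ENNReal.ofReal r * (A * (ENNReal.ofReal (r - r / p))⁻¹)), ?_, ?_⟩
  · refine ENNReal.mul_ne_top (ENNReal.rpow_ne_top_of_nonneg hr.le hMt)
      (ENNReal.mul_ne_top (by simp) (ENNReal.mul_ne_top hA ?_))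
    simpa using hrp
  intro f hf hf1
  set u : E → ℝ≥0∞ := fun x => rieszPotential μ γ f x / M with hu
  have hum : Measurable u := (measurable_rieszPotential μ γ hf).div_const _
  have hlevel : ∀ τ ∈ Set.Ioi (0 : ℝ),
      ENNReal.ofReal τ ^ (r - 1) * μ {x | ENNReal.ofReal τ < u x} ≤
        A * (ENNReal.ofReal τ ^ (r - r / p - 1) *
          ∫⁻ y in {y | ENNReal.ofReal τ < f y ^ (p / r)}, f y ∂μ) := by
    intro τ hτ
    have hτ : 0 < τ := hτ
    set T := ENNReal.ofReal τ with hT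
    have hT0 : T ≠ 0 := by simpa [hT] using hτ
    have hTt : T ≠ ⊤ := by simp [hT]
    obtain ⟨S, hSm, hS1, hS2⟩ := hAB f hf hf1 (τ ^ (-r / d)) (T ^ (r / p)) (by positivity)
    rw [← ENNReal.ofReal_rpow_of_pos hτ, ← hT] at hS1 hS2
    simp only [← ENNReal.rpow_mul, e1, e2] at hS1 hS2
    have hset : {y | T ^ (r / p) < f y} = {y | T < f y ^ (p / r)} := by
      ext y
      simp only [Set.mem_ofPred_eq]
      rw [← inv_div r p, ENNReal.lt_rpow_inv_iff (by positivity)]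
    rw [hset] at hS1
    have hsub : {x | T < u x} ⊆ {x | T ≤ S x} := by
      intro x hx
      have hx : T < rieszPotential μ γ f x / M := hx
      rw [ENNReal.lt_div_iff_mul_lt (Or.inl hM0) (Or.inl hMt)] at hx
      have hx2 := hx.trans_le (hS2 x)
      rw [ENNReal.rpow_one, mul_assoc A, ← ENNReal.rpow_add _ _ hT0 hTt, sub_add_cancel,
        ENNReal.rpow_one, hM, mul_add, mul_one, mul_comm T, add_mul] at hx2
      refine le_of_lt (lt_of_add_lt_add_left hx2)
    have hmeas : T * μ {x | T < u x} ≤ A * T ^ (1 - r / p) * ∫⁻ y in {y | T < f y ^ (p / r)}, f y ∂μ :=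
      calc T * μ {x | T < u x} ≤ T * μ {x | T ≤ S x} := by gcongr
        _ ≤ ∫⁻ x, S x ∂μ := mul_meas_ge_le_lintegral hSm T
        _ = _ := hS1
    calc T ^ (r - 1) * μ {x | T < u x} = T ^ (r - 2) * (T * μ {x | T < u x}) := by
          rw [← mul_assoc]
          congr 1
          conv_rhs => rw [← ENNReal.rpow_one T, ← ENNReal.rpow_mul, one_mul,
            ← ENNReal.rpow_add _ _ hT0 hTt]
          congr 1; ring
      _ ≤ T ^ (r - 2) * (A * T ^ (1 - r / p) * ∫⁻ y in {y | T < f y ^ (p / r)}, f y ∂μ) := by gcongr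
      _ = _ := by
          have : T ^ (r - r / p - 1) = T ^ (r - 2) * T ^ (1 - r / p) := by
            rw [← ENNReal.rpow_add _ _ hT0 hTt]; congr 1; ring
          rw [this]; ring
  have hjoint : ∀ (v : E → ℝ≥0∞) (a : ℝ), Measurable v → Measurable (Function.uncurry
      fun (x : E) (τ : ℝ) => {τ : ℝ | ENNReal.ofReal τ < v x}.indicator
        (fun τ => ENNReal.ofReal τ ^ a) τ) := fun v a hv =>
    (by fun_prop : Measurable fun z : E × ℝ => ENNReal.ofReal z.2 ^ a).indicator
      (measurableSet_lt (by fun_prop) (by fun_prop) :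
        MeasurableSet {z : E × ℝ | ENNReal.ofReal z.2 < v z.1})
  have hr0 : ENNReal.ofReal r ≠ 0 := by simpa using hr
  have hlayer : ∫⁻ x, u x ^ r ∂μ =
      ENNReal.ofReal r * ∫⁻ τ in Set.Ioi (0 : ℝ),
        ENNReal.ofReal τ ^ (r - 1) * μ {x | ENNReal.ofReal τ < u x} := by
    have h1 : ∀ x, u x ^ r = ENNReal.ofReal r * ∫⁻ τ in Set.Ioi (0 : ℝ),
        {τ : ℝ | ENNReal.ofReal τ < u x}.indicator (fun τ => ENNReal.ofReal τ ^ (r - 1)) τ :=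
      fun x => by
        rw [lintegral_indicator_ofReal_lt_rpow hr, ENNReal.mul_div_cancel hr0 (by simp)]
    simp_rw [h1]
    rw [lintegral_const_mul' _ _ (by simp), lintegral_lintegral_swap (hjoint u _ hum).aemeasurable]
    congr 1
    refine lintegral_congr fun τ => ?_
    rw [← lintegral_indicator_const (measurableSet_lt (by fun_prop) hum)]
    rfl
  have hdual : ∫⁻ τ in Set.Ioi (0 : ℝ), ENNReal.ofReal τ ^ (r - r / p - 1) *
      ∫⁻ y in {y | ENNReal.ofReal τ < f y ^ (p / r)}, f y ∂μ =
      (∫⁻ y, f y ^ p ∂μ) * (ENNReal.ofReal (r - r / p))⁻¹ := by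
    have hv : Measurable fun y => f y ^ (p / r) := by fun_prop
    have h1 : ∀ τ, ENNReal.ofReal τ ^ (r - r / p - 1) *
        ∫⁻ y in {y | ENNReal.ofReal τ < f y ^ (p / r)}, f y ∂μ =
        ∫⁻ y, f y * {τ : ℝ | ENNReal.ofReal τ < f y ^ (p / r)}.indicator
          (fun τ => ENNReal.ofReal τ ^ (r - r / p - 1)) τ ∂μ := fun τ => by
      rw [← lintegral_indicator (measurableSet_lt (by fun_prop) hv),
        ← lintegral_const_mul _ (hf.indicator (measurableSet_lt (by fun_prop) hv))]
      refine lintegral_congr fun y => ?_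
      by_cases hy : ENNReal.ofReal τ < f y ^ (p / r)
      · rw [Set.indicator_of_mem (by exact hy), Set.indicator_of_mem (by exact hy), mul_comm]
      · rw [Set.indicator_of_notMem (by exact hy), Set.indicator_of_notMem (by exact hy)]; simp
    simp_rw [h1]
    rw [lintegral_lintegral_swap, ← lintegral_mul_const _ (by fun_prop)]
    · refine lintegral_congr fun y => ?_
      rw [lintegral_const_mul _ ((by fun_prop : Measurable fun τ : ℝ =>
          ENNReal.ofReal τ ^ (r - r / p - 1)).indicator
            (measurableSet_lt (by fun_prop) measurable_const)),
        lintegral_indicator_ofReal_lt_rpow hrp, ← ENNReal.rpow_mul, div_eq_mul_inv, ← mul_assoc]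
      congr 1
      have : p / r * (r - r / p) = p - 1 := by field_simp
      rw [this]
      conv_lhs => rw [← ENNReal.rpow_one (f y), ← ENNReal.rpow_mul, one_mul,
        ← ENNReal.rpow_add_of_nonneg _ _ zero_le_one (by linarith)]
      congr 1; ring
    · have := (hjoint _ (r - r / p - 1) hv).comp measurable_swap
      exact ((hf.comp measurable_snd).mul this).aemeasurable
  calc ∫⁻ x, rieszPotential μ γ f x ^ r ∂μ = ∫⁻ x, M ^ r * u x ^ r ∂μ := by
        refine lintegral_congr fun x => ?_
        rw [← ENNReal.mul_rpow_of_nonneg _ _ hr.le, hu, ENNReal.mul_div_cancel hM0 hMt]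
    _ = M ^ r * ∫⁻ x, u x ^ r ∂μ := lintegral_const_mul _ (by fun_prop)
    _ ≤ M ^ r * (ENNReal.ofReal r * (A * (1 * (ENNReal.ofReal (r - r / p))⁻¹))) := by
        rw [hlayer]
        gcongr
        calc _ ≤ _ := setLIntegral_mono' measurableSet_Ioi hlevel
          _ ≤ _ := by rw [lintegral_const_mul' _ _ hA, hdual]; gcongr
    _ = _ := by rw [one_mul]

/-- The Hardy–Littlewood–Sobolev inequality. -/
theorem exists_lintegral_rieszPotential_rpow_le (μ : Measure E) [μ.IsAddHaarMeasure]
    {γ p r : ℝ} (hγ : 0 < γ) (hp : 1 < p) (hr : 0 < r)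
    (h : γ / finrank ℝ E = 1 / p - 1 / r) :
    ∃ C : ℝ≥0∞, C ≠ ⊤ ∧ ∀ f : E → ℝ≥0∞, Measurable f →
      ∫⁻ x, rieszPotential μ γ f x ^ r ∂μ ≤ C * (∫⁻ y, f y ^ p ∂μ) ^ (r / p) := by
  have hp0 : 0 < p := by linarith
  obtain ⟨C, hC, hC'⟩ := exists_lintegral_rieszPotential_rpow_le_of_le_one μ hγ hp hr h
  refine ⟨C + 1, by simp [hC], fun f hf => ?_⟩
  rcases eq_or_ne (∫⁻ y, f y ^ p ∂μ) 0 with h0 | h0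
  · have hf0 : f =ᵐ[μ] 0 := by
      rw [lintegral_eq_zero_iff (by fun_prop)] at h0
      filter_upwards [h0] with y hy
      simpa [hp0, hp0.le, hp0.not_gt] using hy
    have hI : ∀ x, rieszPotential μ γ f x = 0 := fun x => by
      rw [rieszPotential, lintegral_eq_zero_iff (by fun_prop)]
      filter_upwards [hf0] with y hy
      simp [hy]
    simp [hI, hr]
  rcases eq_or_ne (∫⁻ y, f y ^ p ∂μ) ⊤ with ht | ht
  · rw [ht, ENNReal.top_rpow_of_pos (by positivity), ENNReal.mul_top (by simp)]
    exact le_top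
  set N := (∫⁻ y, f y ^ p ∂μ) ^ (1 / p) with hN
  have hN0 : N ≠ 0 := by simp [hN, h0, ht]
  have hNt : N ≠ ⊤ := ENNReal.rpow_ne_top_of_nonneg (by positivity) ht
  have hNr : N ^ r = (∫⁻ y, f y ^ p ∂μ) ^ (r / p) := by
    rw [hN, ← ENNReal.rpow_mul]; congr 1; ring
  have hNp : N ^ p = ∫⁻ y, f y ^ p ∂μ := by
    rw [hN, ← ENNReal.rpow_mul, one_div_mul_cancel hp0.ne', ENNReal.rpow_one]
  have h1 := hC' (fun y => N⁻¹ * f y) (by fun_prop) (by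
    simp_rw [ENNReal.mul_rpow_of_nonneg _ _ hp0.le]
    rw [lintegral_const_mul _ (by fun_prop), ← hNp, ENNReal.inv_rpow,
      ENNReal.inv_mul_cancel (by simp [hN0, hNt, hp0]) (by simp [hN0, hNt])])
  have h2 : ∀ x, rieszPotential μ γ f x = N * rieszPotential μ γ (fun y => N⁻¹ * f y) x := fun x => by
    rw [rieszPotential, rieszPotential, ← lintegral_const_mul _ (by fun_prop)]
    refine lintegral_congr fun y => ?_
    rw [mul_left_comm N, ← mul_assoc N, ENNReal.mul_inv_cancel hN0 hNt, one_mul]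
  simp_rw [h2, ENNReal.mul_rpow_of_nonneg _ _ hr.le]
  rw [lintegral_const_mul _ ((measurable_rieszPotential μ γ (by fun_prop)).pow_const _), hNr, mul_comm]
  gcongr
  exact h1.trans le_self_add

end Riesz

section Slice

variable {n : ℕ}

lemma mem_cube_comm {x y : EuclideanSpace ℝ (Fin n)} {t : ℝ} : y ∈ cube x t ↔ x ∈ cube y t := by
  simp only [cube, Set.mem_ofPred_eq, abs_sub_comm]

lemma measurableSet_mem_cube (t : ℝ) :
    MeasurableSet {z : EuclideanSpace ℝ (Fin n) × EuclideanSpace ℝ (Fin n) | z.2 ∈ cube z.1 t} := by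
  have : {z : EuclideanSpace ℝ (Fin n) × EuclideanSpace ℝ (Fin n) | z.2 ∈ cube z.1 t} =
      ⋂ i, {z | |z.2 i - z.1 i| ≤ t / 2} := by
    ext z; simp [cube]
  rw [this]
  exact MeasurableSet.iInter fun i => measurableSet_le (by fun_prop) (by fun_prop)

lemma measurableSet_cube (x : EuclideanSpace ℝ (Fin n)) (t : ℝ) : MeasurableSet (cube x t) :=
  (measurableSet_mem_cube t).preimage (measurable_prodMk_left (x := x))

lemma volume_cube (x : EuclideanSpace ℝ (Fin n)) {t : ℝ} (ht : 0 ≤ t) :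
    volume (cube x t) = ENNReal.ofReal t ^ (n : ℝ) := by
  have h : cube x t = (MeasurableEquiv.toLp 2 (Fin n → ℝ)).symm ⁻¹' closedBall x.ofLp (t / 2) := by
    ext y
    simp only [cube, Set.mem_ofPred_eq, Set.mem_preimage, mem_closedBall]
    rw [dist_pi_le_iff (by positivity)]
    rfl
  rw [h, (EuclideanSpace.volume_preserving_symm_measurableEquiv_toLp (Fin n)).measure_preimage
    measurableSet_closedBall.nullMeasurableSet, Real.volume_pi_closedBall _ (by positivity),
    mul_div_cancel₀ _ two_ne_zero, Fintype.card_fin, ENNReal.ofReal_pow ht, ENNReal.rpow_natCast]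

lemma mem_cube_of_norm_le {x y : EuclideanSpace ℝ (Fin n)} {t : ℝ} (h : ‖y - x‖ ≤ t / 2) :
    y ∈ cube x t := fun i => by
  have := (PiLp.norm_apply_le (y - x) i).trans h
  simpa using this

lemma norm_sub_le_of_mem_cube {x y : EuclideanSpace ℝ (Fin n)} {t : ℝ} (ht : 0 ≤ t)
    (h : y ∈ cube x t) : ‖y - x‖ ≤ n * t := by
  rw [EuclideanSpace.norm_eq]
  refine Real.sqrt_le_iff.2 ⟨by positivity, ?_⟩
  calc ∑ i, ‖(y - x).ofLp i‖ ^ 2 ≤ ∑ _i : Fin n, t ^ 2 := by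
        refine Finset.sum_le_sum fun i _ => ?_
        have h1 : ‖(y - x).ofLp i‖ ≤ t / 2 := by simpa using h i
        exact pow_le_pow_left₀ (norm_nonneg _) (by linarith) 2
    _ = n * t ^ 2 := by simp
    _ ≤ n ^ 2 * t ^ 2 := by
        gcongr
        exact_mod_cast Nat.le_self_pow two_ne_zero n
    _ = (n * t) ^ 2 := by ring

/-- The `L^p` mean of `g` over the cube of side `t` centered at `x`. -/
def cubeMean (p t : ℝ) (g : EuclideanSpace ℝ (Fin n) → ℝ≥0∞) (x : EuclideanSpace ℝ (Fin n)) :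
    ℝ≥0∞ :=
  ((volume (cube x t))⁻¹ * ∫⁻ y in cube x t, g y ^ p) ^ (1 / p)

lemma sliceNormE_eq (p q t : ℝ) (g : EuclideanSpace ℝ (Fin n) → ℝ≥0∞) :
    sliceNormE p q t g = (∫⁻ x, cubeMean p t g x ^ q) ^ (1 / q) := by
  simp only [sliceNormE, cubeMean, ← ENNReal.rpow_mul, one_div_mul_eq_div]

lemma measurable_lintegral_cube (t : ℝ) {g : EuclideanSpace ℝ (Fin n) → ℝ≥0∞} (hg : Measurable g) :
    Measurable fun x => ∫⁻ y in cube x t, g y := by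
  simp_rw [← lintegral_indicator (measurableSet_cube _ t)]
  exact Measurable.lintegral_prod_right'
    (f := {z : EuclideanSpace ℝ (Fin n) × EuclideanSpace ℝ (Fin n) |
      z.2 ∈ cube z.1 t}.indicator fun z => g z.2)
    ((hg.comp measurable_snd).indicator (measurableSet_mem_cube t))

lemma measurable_cubeMean (p : ℝ) {t : ℝ} (ht : 0 ≤ t) {g : EuclideanSpace ℝ (Fin n) → ℝ≥0∞}
    (hg : Measurable g) : Measurable (cubeMean p t g) := by
  unfold cubeMean
  simp_rw [volume_cube _ ht]
  exact ((measurable_lintegral_cube t (hg.pow_const p)).const_mul _).pow_const _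

lemma lintegral_cube_le_cubeMean {p t : ℝ} (hp : 1 < p) (ht : 0 < t)
    {g : EuclideanSpace ℝ (Fin n) → ℝ≥0∞} (hg : Measurable g) (x : EuclideanSpace ℝ (Fin n)) :
    (volume (cube x t))⁻¹ * ∫⁻ y in cube x t, g y ≤ cubeMean p t g x := by
  have hp0 : 0 < p := by linarith
  have hV : volume (cube x t) ≠ 0 := by rw [volume_cube _ ht.le]; simp [ht]
  have hVt : volume (cube x t) ≠ ⊤ := by
    rw [volume_cube _ ht.le]; exact ENNReal.rpow_ne_top_of_nonneg (by positivity) (by simp)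
  have hpp' := Real.HolderConjugate.conjExponent hp
  have hp' : 1 / p.conjExponent = 1 - 1 / p := by
    have := hpp'.inv_add_inv_eq_one
    simp only [one_div]; linarith
  have h := ENNReal.lintegral_mul_le_Lp_mul_Lq (volume.restrict (cube x t)) hpp'
    (f := g) (g := fun _ => 1) hg.aemeasurable aemeasurable_const
  simp only [Pi.mul_apply, mul_one, ENNReal.one_rpow, lintegral_one, Measure.restrict_apply_univ,
    hp'] at h
  calc _ ≤ (volume (cube x t))⁻¹ * ((∫⁻ y in cube x t, g y ^ p) ^ (1 / p) *
        volume (cube x t) ^ (1 - 1 / p)) := by gcongr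
    _ = _ := by
      rw [cubeMean, ENNReal.mul_rpow_of_nonneg _ _ (by positivity), mul_comm _ (_ ^ (1 - 1 / p)),
        ← mul_assoc, ← ENNReal.rpow_neg_one, ← ENNReal.rpow_mul, ← ENNReal.rpow_add _ _ hV hVt]
      congr 2; ring

lemma rpow_le_rpow_of_nonpos' {a b : ℝ≥0∞} (h : a ≤ b) {z : ℝ} (hz : z ≤ 0) : b ^ z ≤ a ^ z := by
  rw [← neg_neg z, ENNReal.rpow_neg b, ENNReal.rpow_neg a, ENNReal.inv_le_inv]
  exact ENNReal.rpow_le_rpow h (by linarith)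

/-- Contribution of points far from `x` to the Riesz potential at points of the cube at `x`. -/
lemma rieszPotential_far_le {γ p t : ℝ} (hγ : γ < n) (hp : 1 < p) (ht : 0 < t)
    {g : EuclideanSpace ℝ (Fin n) → ℝ≥0∞} (hg : Measurable g) {x y : EuclideanSpace ℝ (Fin n)}
    (hy : y ∈ cube x t) :
    rieszPotential volume γ ({z | 3 * n * t ≤ ‖z - x‖}.indicator g) y ≤
      2 ^ (n - γ) * rieszPotential volume γ (cubeMean p t g) x := by
  have hγ' : γ - n ≤ 0 := by linarith
  set V := ENNReal.ofReal t ^ (n : ℝ) with hVdef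
  have hV : V ≠ 0 := by simp [hVdef, ht]
  have hVt : V ≠ ⊤ := ENNReal.rpow_ne_top_of_nonneg (by positivity) (by simp)
  have hpt : ∀ z w, 3 * n * t ≤ ‖z - x‖ → w ∈ cube z t →
      ‖y - z‖ₑ ^ (γ - n) ≤ 2 ^ (n - γ) * ‖x - w‖ₑ ^ (γ - n) := by
    intro z w hz hw
    have h1 := norm_sub_le_of_mem_cube ht.le hy
    have h2 := norm_sub_le_of_mem_cube ht.le hw
    have h3 : ‖x - w‖ ≤ 2 * ‖y - z‖ := by
      have h4 : ‖z - x‖ ≤ ‖y - z‖ + ‖y - x‖ := by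
        have := norm_sub_le_norm_sub_add_norm_sub z y x
        rwa [norm_sub_rev z y] at this
      have h5 : ‖x - w‖ ≤ ‖z - x‖ + ‖w - z‖ := by
        have := norm_sub_le_norm_sub_add_norm_sub x z w
        rwa [norm_sub_rev x z, norm_sub_rev z w] at this
      linarith
    have h6 : ‖x - w‖ₑ ≤ 2 * ‖y - z‖ₑ := by
      have := ENNReal.ofReal_le_ofReal h3
      rwa [ENNReal.ofReal_mul zero_le_two, ofReal_norm, ofReal_norm, ENNReal.ofReal_ofNat] at this
    calc ‖y - z‖ₑ ^ (γ - n) = 2 ^ (n - γ) * (2 * ‖y - z‖ₑ) ^ (γ - n) := by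
          rw [ENNReal.mul_rpow_of_ne_top (by simp) (by simp), ← mul_assoc,
            ← ENNReal.rpow_add _ _ (by simp) (by simp)]
          simp
      _ ≤ _ := mul_le_mul_right (rpow_le_rpow_of_nonpos' h6 hγ') _
  have hk : Measurable fun w : EuclideanSpace ℝ (Fin n) => ‖x - w‖ₑ ^ (γ - n) := by fun_prop
  set J : EuclideanSpace ℝ (Fin n) × EuclideanSpace ℝ (Fin n) → ℝ≥0∞ :=
    {u | u.2 ∈ cube u.1 t}.indicator fun u => ‖x - u.2‖ₑ ^ (γ - n) * g u.1 with hJ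
  have hz : ∀ z, ‖y - z‖ₑ ^ (γ - n) * {z | 3 * n * t ≤ ‖z - x‖}.indicator g z ≤
      2 ^ (n - γ) * V⁻¹ * ∫⁻ w, J (z, w) := by
    intro z
    by_cases hzx : 3 * n * t ≤ ‖z - x‖
    · rw [Set.indicator_of_mem (by exact hzx)]
      have e1 : ∫⁻ w, J (z, w) =
          (∫⁻ w in cube z t, ‖x - w‖ₑ ^ (γ - n)) * g z := by
        rw [← lintegral_mul_const _ hk, ← lintegral_indicator (measurableSet_cube z t)]
        rfl
      rw [e1, ← mul_assoc]
      gcongr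
      calc ‖y - z‖ₑ ^ (γ - n) = V⁻¹ * ∫⁻ _w in cube z t, ‖y - z‖ₑ ^ (γ - n) := by
            rw [setLIntegral_const, volume_cube z ht.le, mul_comm (_ ^ (γ - n)), ← mul_assoc,
              ENNReal.inv_mul_cancel hV hVt, one_mul]
        _ ≤ V⁻¹ * ∫⁻ w in cube z t, 2 ^ (n - γ) * ‖x - w‖ₑ ^ (γ - n) := by
            gcongr 1
            exact setLIntegral_mono' (measurableSet_cube z t) fun w hw => hpt z w hzx hw
        _ = _ := by rw [lintegral_const_mul _ hk]; ring
    · rw [Set.indicator_of_notMem (by exact hzx), mul_zero]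
      exact zero_le
  have hjm : Measurable J :=
    (by fun_prop : Measurable fun u : EuclideanSpace ℝ (Fin n) × EuclideanSpace ℝ (Fin n) =>
      ‖x - u.2‖ₑ ^ (γ - n) * g u.1).indicator (measurableSet_mem_cube t)
  simp only [rieszPotential, finrank_euclideanSpace_fin]
  calc _ ≤ _ := lintegral_mono hz
    _ = 2 ^ (n - γ) * ∫⁻ w, V⁻¹ * ∫⁻ z, J (z, w) := by
        rw [lintegral_const_mul _ hjm.lintegral_prod_right', mul_assoc,
          lintegral_const_mul _ hjm.lintegral_prod_left',
          lintegral_lintegral_swap (f := fun z w => J (z, w)) hjm.aemeasurable]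
    _ ≤ _ := by
        refine mul_le_mul_right (lintegral_mono fun w => ?_) _
        have e2 : ∫⁻ z, J (z, w) =
            ‖x - w‖ₑ ^ (γ - n) * ∫⁻ z in cube w t, g z := by
          rw [← lintegral_const_mul _ hg, ← lintegral_indicator (measurableSet_cube w t)]
          refine lintegral_congr fun z => ?_
          by_cases hzw : z ∈ cube w t
          · rw [Set.indicator_of_mem hzw, hJ, Set.indicator_of_mem (by exact mem_cube_comm.1 hzw)]
          · rw [Set.indicator_of_notMem hzw, hJ,
              Set.indicator_of_notMem (by exact fun h => hzw (mem_cube_comm.1 h))]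
        rw [e2, mul_left_comm]
        gcongr
        rw [hVdef, ← volume_cube w ht.le]
        exact lintegral_cube_le_cubeMean hp ht hg w


lemma lintegral_ball_le_rieszPotential {γ p t : ℝ} (hγ : γ < n) (hp : 0 < p) (ht : 0 < t)
    (g : EuclideanSpace ℝ (Fin n) → ℝ≥0∞) {x c : EuclideanSpace ℝ (Fin n)}
    (hc : ‖c - x‖ ≤ 3 * n * t) :
    ENNReal.ofReal ((1 / 4) ^ n) * volume (ball (0 : EuclideanSpace ℝ (Fin n)) 1) *
      ENNReal.ofReal (3 * n + 1) ^ (γ - n) * ENNReal.ofReal t ^ (γ - n / p) *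
      (∫⁻ y in ball c (t / 4), g y ^ p) ^ (1 / p) ≤
        rieszPotential volume γ (cubeMean p t g) x := by
  have hγ' : γ - n ≤ 0 := by linarith
  set T := ENNReal.ofReal t with hT
  have hT0 : T ≠ 0 := by simpa [hT] using ht
  have hTt : T ≠ ⊤ := by simp [hT]
  set X := ∫⁻ y in ball c (t / 4), g y ^ p with hX
  have hvol : volume (ball c (t / 4)) = ENNReal.ofReal ((1 / 4) ^ n) *
      volume (ball (0 : EuclideanSpace ℝ (Fin n)) 1) * T ^ (n : ℝ) := by
    rw [Measure.addHaar_ball_of_pos _ _ (by positivity), finrank_euclideanSpace_fin,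
      div_eq_mul_one_div,
      mul_pow, ENNReal.ofReal_mul (by positivity), ENNReal.ofReal_pow ht.le, ENNReal.rpow_natCast]
    ring
  have hlow : ∀ z ∈ ball c (t / 4), (ENNReal.ofReal (3 * n + 1) * T) ^ (γ - n) *
      ((T ^ (n : ℝ))⁻¹ * X) ^ (1 / p) ≤ ‖x - z‖ₑ ^ (γ - n) * cubeMean p t g z := by
    intro z hz
    rw [mem_ball_iff_norm] at hz
    gcongr ?_ * ?_
    · refine rpow_le_rpow_of_nonpos' ?_ hγ'
      rw [hT, ← ENNReal.ofReal_mul (by positivity), ← ofReal_norm]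
      refine ENNReal.ofReal_le_ofReal ?_
      have h1 := norm_sub_le_norm_sub_add_norm_sub x c z
      rw [norm_sub_rev x c, norm_sub_rev c z] at h1
      linarith
    · rw [cubeMean, volume_cube z ht.le]
      gcongr
      refine lintegral_mono_set fun y hy => mem_cube_of_norm_le ?_
      rw [mem_ball_iff_norm] at hy
      have h1 := norm_sub_le_norm_sub_add_norm_sub y c z
      rw [norm_sub_rev c z] at h1
      linarith
  calc _ = ∫⁻ _z in ball c (t / 4), (ENNReal.ofReal (3 * n + 1) * T) ^ (γ - n) *
        ((T ^ (n : ℝ))⁻¹ * X) ^ (1 / p) := by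
        have e : T ^ (γ - n / p) = T ^ (γ - n) * T ^ (-(n / p)) * T ^ (n : ℝ) := by
          rw [← ENNReal.rpow_add _ _ hT0 hTt, ← ENNReal.rpow_add _ _ hT0 hTt]
          congr 1; ring
        rw [setLIntegral_const, hvol, ENNReal.mul_rpow_of_ne_top (by simp) hTt,
          ENNReal.mul_rpow_of_nonneg _ _ (by positivity), ← ENNReal.rpow_neg, ← ENNReal.rpow_mul,
          e, mul_one_div, neg_div]
        ring
    _ ≤ ∫⁻ z in ball c (t / 4), ‖x - z‖ₑ ^ (γ - n) * cubeMean p t g z :=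
        setLIntegral_mono' measurableSet_ball hlow
    _ ≤ _ := by
        rw [rieszPotential, finrank_euclideanSpace_fin]
        exact setLIntegral_le_lintegral _ _

lemma exists_lintegral_near_le {γ p : ℝ} (hγ : γ < n) (hp : 0 < p) :
    ∃ C : ℝ≥0∞, C ≠ ⊤ ∧ ∀ (t : ℝ) (g : EuclideanSpace ℝ (Fin n) → ℝ≥0∞)
      (x : EuclideanSpace ℝ (Fin n)), 0 < t →
        ∫⁻ z in {z | ‖z - x‖ < 3 * n * t}, g z ^ p ≤
          C * ENNReal.ofReal t ^ (n - γ * p) *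
            rieszPotential volume γ (cubeMean p t g) x ^ p := by
  obtain ⟨F, hF, hFfin, hFcov⟩ := (isCompact_closedBall (0 : EuclideanSpace ℝ (Fin n))
    (3 * n)).finite_cover_balls (e := 1 / 4) (by norm_num)
  set k : ℝ≥0∞ := ENNReal.ofReal ((1 / 4) ^ n) * volume (ball (0 : EuclideanSpace ℝ (Fin n)) 1) *
      ENNReal.ofReal (3 * n + 1) ^ (γ - n) with hk
  have hK : ENNReal.ofReal (3 * n + 1) ≠ 0 := by
    rw [Ne, ENNReal.ofReal_eq_zero]; push Not; positivity
  have hk0 : k ≠ 0 := by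
    refine mul_ne_zero (mul_ne_zero (by simp) (measure_ball_pos _ _ one_pos).ne') ?_
    simp [ENNReal.rpow_eq_zero_iff, hK]
  have hkt : k ≠ ⊤ := ENNReal.mul_ne_top (ENNReal.mul_ne_top (by simp) measure_ball_lt_top.ne)
    (ENNReal.rpow_ne_top_of_ne_zero hK (by simp))
  refine ⟨hFfin.toFinset.card * k⁻¹ ^ p, ENNReal.mul_ne_top (by simp)
    (ENNReal.rpow_ne_top_of_nonneg hp.le (by simpa using hk0)), fun t g x ht => ?_⟩
  set T := ENNReal.ofReal t with hT
  have hT0 : T ≠ 0 := by simpa [hT] using ht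
  have hTt : T ≠ ⊤ := by simp [hT]
  have hball : ∀ v ∈ F, ∫⁻ y in ball (x + t • v) (t / 4), g y ^ p ≤
      k⁻¹ ^ p * T ^ (n - γ * p) * rieszPotential volume γ (cubeMean p t g) x ^ p := by
    intro v hv
    have hv' : ‖v‖ ≤ 3 * n := by simpa using hF hv
    have h1 := lintegral_ball_le_rieszPotential hγ hp ht g (x := x) (c := x + t • v) (by
      rw [add_sub_cancel_left, norm_smul, Real.norm_of_nonneg ht.le, mul_comm]
      gcongr)
    rw [← hk, ← hT] at h1
    have h2 := ENNReal.rpow_le_rpow h1 hp.le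
    rw [ENNReal.mul_rpow_of_nonneg _ _ hp.le, ENNReal.mul_rpow_of_nonneg _ _ hp.le,
      ← ENNReal.rpow_mul, ← ENNReal.rpow_mul, one_div_mul_cancel hp.ne', ENNReal.rpow_one] at h2
    calc _ = k⁻¹ ^ p * T ^ (n - γ * p) * (k ^ p * T ^ ((γ - n / p) * p) *
          ∫⁻ y in ball (x + t • v) (t / 4), g y ^ p) := by
          have e1 : k⁻¹ ^ p * k ^ p = 1 := by
            rw [← ENNReal.mul_rpow_of_nonneg _ _ hp.le, ENNReal.inv_mul_cancel hk0 hkt,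
              ENNReal.one_rpow]
          have e2 : T ^ (n - γ * p) * T ^ ((γ - n / p) * p) = 1 := by
            rw [← ENNReal.rpow_add _ _ hT0 hTt]
            have : n - γ * p + (γ - n / p) * p = 0 := by field_simp; ring
            rw [this, ENNReal.rpow_zero]
          calc _ = (k⁻¹ ^ p * k ^ p) * (T ^ (n - γ * p) * T ^ ((γ - n / p) * p)) *
                ∫⁻ y in ball (x + t • v) (t / 4), g y ^ p := by rw [e1, e2, one_mul, one_mul]
            _ = _ := by ring
      _ ≤ _ := by gcongr
  have hcov : {z | ‖z - x‖ < 3 * n * t} ⊆ ⋃ v : hFfin.toFinset, ball (x + t • v.1) (t / 4) := by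
    intro z hz
    have hz : ‖z - x‖ < 3 * n * t := hz
    have h1 : t⁻¹ • (z - x) ∈ closedBall (0 : EuclideanSpace ℝ (Fin n)) (3 * n) := by
      rw [mem_closedBall_zero_iff, norm_smul, norm_inv, Real.norm_of_nonneg ht.le,
        inv_mul_le_iff₀ ht]
      linarith
    obtain ⟨v, hv, hzv⟩ := Set.mem_iUnion₂.1 (hFcov h1)
    refine Set.mem_iUnion.2 ⟨⟨v, by simpa using hv⟩, ?_⟩
    rw [mem_ball_iff_norm] at hzv ⊢
    have h2 : z - (x + t • v) = t • (t⁻¹ • (z - x) - v) := by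
      rw [smul_sub, smul_smul, mul_inv_cancel₀ ht.ne', one_smul]; abel
    rw [h2, norm_smul, Real.norm_of_nonneg ht.le]
    nlinarith
  calc _ ≤ ∫⁻ z in ⋃ v : hFfin.toFinset, ball (x + t • v.1) (t / 4), g z ^ p :=
        lintegral_mono_set hcov
    _ ≤ ∑ v ∈ hFfin.toFinset, ∫⁻ z in ball (x + t • v) (t / 4), g z ^ p := by
        rw [← Finset.sum_coe_sort, ← tsum_fintype (L := .unconditional _)]
        exact lintegral_iUnion_le _ _
    _ ≤ ∑ _v ∈ hFfin.toFinset, k⁻¹ ^ p * T ^ (n - γ * p) *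
          rieszPotential volume γ (cubeMean p t g) x ^ p :=
        Finset.sum_le_sum fun v hv => hball v (by simpa using hv)
    _ = _ := by rw [Finset.sum_const, nsmul_eq_mul]; ring

/-- Local control of the Riesz potential by the Riesz potential of the local means. -/
lemma exists_cubeMean_rieszPotential_le (hn : 1 ≤ n) {γ p r : ℝ} (hγ0 : 0 < γ) (hγ : γ < n)
    (hp : 1 < p) (hr : 1 < r) (h : γ / n = 1 / p - 1 / r) :
    ∃ C : ℝ≥0∞, C ≠ ⊤ ∧ ∀ (t : ℝ) (g : EuclideanSpace ℝ (Fin n) → ℝ≥0∞)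
      (x : EuclideanSpace ℝ (Fin n)), 0 < t → Measurable g →
        cubeMean r t (rieszPotential volume γ g) x ≤
          C * rieszPotential volume γ (cubeMean p t g) x := by
  have hp0 : 0 < p := by linarith
  have hr0 : 0 < r := by linarith
  have hn0 : (0 : ℝ) < n := by exact_mod_cast hn
  have : Nonempty (Fin n) := ⟨⟨0, hn⟩⟩
  obtain ⟨C₀, hC₀, hls⟩ := exists_lintegral_rieszPotential_rpow_le
    (volume : Measure (EuclideanSpace ℝ (Fin n))) (γ := γ) (p := p) (r := r) hγ0 hp hr0
    (by rwa [finrank_euclideanSpace_fin])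
  obtain ⟨C₁, hC₁, hnear⟩ := exists_lintegral_near_le (n := n) hγ hp0
  have hrp : 0 ≤ r / p := by positivity
  refine ⟨(2 ^ (r - 1) * (C₀ * C₁ ^ (r / p) + (2 ^ (n - γ)) ^ r)) ^ (1 / r), ?_, ?_⟩
  · have h2 : ∀ a : ℝ, (2 : ℝ≥0∞) ^ a ≠ ⊤ := fun a =>
      ENNReal.rpow_ne_top_of_ne_zero two_ne_zero (by simp)
    exact ENNReal.rpow_ne_top_of_nonneg (by positivity) (ENNReal.mul_ne_top (h2 _)
      (ENNReal.add_ne_top.2 ⟨ENNReal.mul_ne_top hC₀ (ENNReal.rpow_ne_top_of_nonneg hrp hC₁),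
        ENNReal.rpow_ne_top_of_nonneg hr0.le (h2 _)⟩))
  intro t g x ht hg
  set T := ENNReal.ofReal t with hT
  have hT0 : T ≠ 0 := by simpa [hT] using ht
  have hTt : T ≠ ⊤ := by simp [hT]
  set Φ := rieszPotential volume γ (cubeMean p t g) x with hΦ
  have hset : MeasurableSet {z : EuclideanSpace ℝ (Fin n) | ‖z - x‖ < 3 * n * t} :=
    measurableSet_lt (by fun_prop) (by fun_prop)
  set g₁ := {z | ‖z - x‖ < 3 * n * t}.indicator g with hg₁
  set g₂ := {z | 3 * n * t ≤ ‖z - x‖}.indicator g with hg₂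
  have hg₁m : Measurable g₁ := hg.indicator hset
  have hsplit : ∀ y, rieszPotential volume γ g y =
      rieszPotential volume γ g₁ y + rieszPotential volume γ g₂ y := by
    intro y
    simp only [rieszPotential]
    rw [← lintegral_add_left (by fun_prop)]
    refine lintegral_congr fun z => ?_
    rw [← mul_add]
    congr 1
    by_cases hz : ‖z - x‖ < 3 * n * t
    · rw [hg₁, hg₂, Set.indicator_of_mem (by exact hz),
        Set.indicator_of_notMem (by exact not_le.2 hz), add_zero]
    · rw [hg₁, hg₂, Set.indicator_of_notMem (by exact hz),
        Set.indicator_of_mem (by exact not_lt.1 hz), zero_add]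
  have hV0 : volume (cube x t) ≠ 0 := by rw [volume_cube _ ht.le]; simp [ht]
  have hVt : volume (cube x t) ≠ ⊤ := by
    rw [volume_cube _ ht.le]; exact ENNReal.rpow_ne_top_of_nonneg (by positivity) (by simp)
  have hnear' : (volume (cube x t))⁻¹ * ∫⁻ y in cube x t, rieszPotential volume γ g₁ y ^ r ≤
      C₀ * C₁ ^ (r / p) * Φ ^ r := by
    have e1 : ∫⁻ z, g₁ z ^ p = ∫⁻ z in {z | ‖z - x‖ < 3 * n * t}, g z ^ p := by
      rw [← lintegral_indicator hset]
      refine lintegral_congr fun z => ?_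
      by_cases hz : ‖z - x‖ < 3 * n * t
      · rw [hg₁, Set.indicator_of_mem (by exact hz), Set.indicator_of_mem (by exact hz)]
      · rw [hg₁, Set.indicator_of_notMem (by exact hz), Set.indicator_of_notMem (by exact hz),
          ENNReal.zero_rpow_of_pos hp0]
    have e2 : (n - γ * p) * (r / p) = n := by
      have : (n - γ * p) * (r / p) = n * (r / p) - n * (γ / n) * r := by field_simp
      rw [this, h]; field_simp; ring
    calc _ ≤ (T ^ (n : ℝ))⁻¹ * ∫⁻ y, rieszPotential volume γ g₁ y ^ r := by
          rw [volume_cube x ht.le]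
          gcongr
          exact Measure.restrict_le_self
      _ ≤ (T ^ (n : ℝ))⁻¹ * (C₀ * (C₁ * T ^ (n - γ * p) * Φ ^ p) ^ (r / p)) := by
          gcongr
          refine (hls g₁ hg₁m).trans ?_
          rw [e1]
          gcongr
          exact hnear t g x ht
      _ = ((T ^ (n : ℝ))⁻¹ * T ^ (n : ℝ)) * (C₀ * C₁ ^ (r / p) * Φ ^ r) := by
          rw [ENNReal.mul_rpow_of_nonneg _ _ hrp, ENNReal.mul_rpow_of_nonneg _ _ hrp,
            ← ENNReal.rpow_mul, ← ENNReal.rpow_mul, e2, mul_div_cancel₀ _ hp0.ne']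
          ring
      _ = _ := by
          rw [ENNReal.inv_mul_cancel _ (ENNReal.rpow_ne_top_of_nonneg hn0.le hTt), one_mul]
          simp [hT0]
  have hfar' : (volume (cube x t))⁻¹ * ∫⁻ y in cube x t, rieszPotential volume γ g₂ y ^ r ≤
      (2 ^ (n - γ)) ^ r * Φ ^ r := by
    calc _ ≤ (volume (cube x t))⁻¹ * ∫⁻ _y in cube x t, (2 ^ (n - γ) * Φ) ^ r := by
          gcongr 1
          exact setLIntegral_mono' (measurableSet_cube x t) fun y hy => by
            gcongr
            exact rieszPotential_far_le hγ hp ht hg hy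
      _ = _ := by
          rw [setLIntegral_const, mul_comm, mul_assoc, ENNReal.mul_inv_cancel hV0 hVt, mul_one,
            ENNReal.mul_rpow_of_nonneg _ _ hr0.le]
  have hmain : (volume (cube x t))⁻¹ * ∫⁻ y in cube x t, rieszPotential volume γ g y ^ r ≤
      2 ^ (r - 1) * (C₀ * C₁ ^ (r / p) + (2 ^ (n - γ)) ^ r) * Φ ^ r :=
    calc _ ≤ (volume (cube x t))⁻¹ * ∫⁻ y in cube x t, 2 ^ (r - 1) *
          (rieszPotential volume γ g₁ y ^ r + rieszPotential volume γ g₂ y ^ r) := by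
          gcongr with y
          rw [hsplit]
          exact ENNReal.rpow_add_le_mul_rpow_add_rpow _ _ hr.le
      _ = 2 ^ (r - 1) *
          ((volume (cube x t))⁻¹ * (∫⁻ y in cube x t, rieszPotential volume γ g₁ y ^ r) +
            (volume (cube x t))⁻¹ * ∫⁻ y in cube x t, rieszPotential volume γ g₂ y ^ r) := by
          rw [lintegral_const_mul' _ _ (ENNReal.rpow_ne_top_of_ne_zero two_ne_zero (by simp)),
            lintegral_add_left ((measurable_rieszPotential volume γ hg₁m).pow_const _)]
          ring
      _ ≤ 2 ^ (r - 1) * (C₀ * C₁ ^ (r / p) * Φ ^ r + (2 ^ (n - γ)) ^ r * Φ ^ r) := by gcongr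
      _ = _ := by ring
  calc _ ≤ _ := ENNReal.rpow_le_rpow hmain (by positivity)
    _ = _ := by
      rw [ENNReal.mul_rpow_of_nonneg _ _ (by positivity), ← ENNReal.rpow_mul Φ,
        mul_one_div_cancel hr0.ne', ENNReal.rpow_one]

/-- Boundedness of the Riesz potential on slice spaces. -/
theorem exists_sliceNormE_rieszPotential_le (hn : 1 ≤ n) {γ p q r s : ℝ} (hγ0 : 0 < γ)
    (hγ : γ < n) (hp : 1 < p) (hr : 1 < r) (hq : 1 < q) (hs : 1 < s)
    (h : γ / n = 1 / p - 1 / r) (h' : γ / n = 1 / q - 1 / s) :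
    ∃ C : ℝ≥0∞, C ≠ ⊤ ∧ ∀ (t : ℝ) (g : EuclideanSpace ℝ (Fin n) → ℝ≥0∞), 0 < t → Measurable g →
        sliceNormE r s t (rieszPotential volume γ g) ≤ C * sliceNormE p q t g := by
  have hq0 : 0 < q := by linarith
  have hs0 : 0 < s := by linarith
  have : Nonempty (Fin n) := ⟨⟨0, hn⟩⟩
  obtain ⟨C₀, hC₀, hls⟩ := exists_lintegral_rieszPotential_rpow_le
    (volume : Measure (EuclideanSpace ℝ (Fin n))) (γ := γ) (p := q) (r := s) hγ0 hq hs0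
    (by rwa [finrank_euclideanSpace_fin])
  obtain ⟨C₁, hC₁, hloc⟩ := exists_cubeMean_rieszPotential_le hn hγ0 hγ hp hr h
  refine ⟨C₁ * C₀ ^ (1 / s), ENNReal.mul_ne_top hC₁
    (ENNReal.rpow_ne_top_of_nonneg (by positivity) hC₀), fun t g ht hg => ?_⟩
  rw [sliceNormE_eq, sliceNormE_eq]
  have hNm := measurable_cubeMean p ht.le hg
  calc _ ≤ (∫⁻ x, C₁ ^ s * rieszPotential volume γ (cubeMean p t g) x ^ s) ^ (1 / s) := by
        gcongr with x
        rw [← ENNReal.mul_rpow_of_nonneg _ _ hs0.le]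
        gcongr
        exact hloc t g x ht hg
    _ = C₁ * (∫⁻ x, rieszPotential volume γ (cubeMean p t g) x ^ s) ^ (1 / s) := by
        rw [lintegral_const_mul _ ((measurable_rieszPotential volume γ hNm).pow_const _),
          ENNReal.mul_rpow_of_nonneg _ _ (by positivity), ← ENNReal.rpow_mul,
          mul_one_div_cancel hs0.ne', ENNReal.rpow_one]
    _ ≤ C₁ * (C₀ * (∫⁻ x, cubeMean p t g x ^ q) ^ (s / q)) ^ (1 / s) := by
        gcongr
        exact hls _ hNm
    _ = _ := by
        rw [ENNReal.mul_rpow_of_nonneg _ _ (by positivity), ← ENNReal.rpow_mul, ← mul_assoc]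
        congr 2
        field_simp

lemma ae_lt_top_of_sliceNormE_ne_top {p q t : ℝ} (hp : 0 < p) (hq : 0 < q) (ht : 0 < t)
    {g : EuclideanSpace ℝ (Fin n) → ℝ≥0∞} (hg : Measurable g) (h : sliceNormE p q t g ≠ ⊤) :
    ∀ᵐ x, g x < ⊤ := by
  rw [sliceNormE_eq] at h
  have h1 : ∫⁻ x, cubeMean p t g x ^ q ≠ ⊤ := fun h2 => h (by
    rw [h2, ENNReal.top_rpow_of_pos (by positivity)])
  have h2 := ae_lt_top ((measurable_cubeMean p ht.le hg).pow_const q) h1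
  refine measure_null_of_locally_null _ fun z _ =>
    ⟨_, inter_mem_nhdsWithin _ (ball_mem_nhds z (show 0 < t / 4 by positivity)), ?_⟩
  obtain ⟨x, hx, hxz⟩ := (Measure.dense_of_ae h2).exists_dist_lt z (show 0 < t / 4 by positivity)
  have h3 : ∫⁻ y in cube x t, g y ^ p ≠ ⊤ := fun h4 => by
    have hx : cubeMean p t g x ^ q < ⊤ := hx
    rw [cubeMean, h4, volume_cube x ht.le, ENNReal.mul_top, ENNReal.top_rpow_of_pos (by positivity),
      ENNReal.top_rpow_of_pos hq] at hx
    · exact hx.ne rfl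
    · simp
  have h4 : ∀ᵐ y ∂volume.restrict (cube x t), g y < ⊤ := by
    filter_upwards [ae_lt_top (hg.pow_const p) h3] with y hy
    by_contra h5
    rw [not_lt_top_iff.1 h5, ENNReal.top_rpow_of_pos hp] at hy
    exact hy.ne rfl
  rw [ae_restrict_iff' (measurableSet_cube x t)] at h4
  refine measure_mono_null ?_ h4
  rintro y ⟨hy, hyz⟩ h5
  refine hy (h5 (mem_cube_of_norm_le ?_))
  rw [mem_ball_iff_norm] at hyz
  rw [dist_eq_norm] at hxz
  have := norm_sub_le_norm_sub_add_norm_sub y z x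
  linarith

lemma HomogZero.eq_normalize {Ω : EuclideanSpace ℝ (Fin n) → ℝ} (h : HomogZero Ω)
    {x : EuclideanSpace ℝ (Fin n)} (hx : x ≠ 0) : Ω x = Ω (‖x‖⁻¹ • x) :=
  (h _ (by positivity) x hx).symm

lemma inv_norm_smul_mem_sphere {x : EuclideanSpace ℝ (Fin n)} (hx : x ≠ 0) :
    ‖x‖⁻¹ • x ∈ sphere (0 : EuclideanSpace ℝ (Fin n)) 1 := by
  rw [mem_sphere_zero_iff_norm, norm_smul, norm_inv, norm_norm,
    inv_mul_cancel₀ (norm_ne_zero_iff.2 hx)]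

lemma HomogZero.exists_bound {Ω : EuclideanSpace ℝ (Fin n) → ℝ} (h : HomogZero Ω)
    (hc : ContinuousOn Ω (sphere 0 1)) : ∃ M : ℝ, 0 ≤ M ∧ ∀ x, x ≠ 0 → |Ω x| ≤ M := by
  obtain ⟨M, hM⟩ := (isCompact_sphere 0 1).exists_bound_of_continuousOn hc
  refine ⟨|M|, abs_nonneg M, fun x hx => ?_⟩
  rw [h.eq_normalize hx]
  exact (hM _ (inv_norm_smul_mem_sphere hx)).trans (le_abs_self M)

lemma HomogZero.measurable {Ω : EuclideanSpace ℝ (Fin n) → ℝ} (h : HomogZero Ω)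
    (hc : ContinuousOn Ω (sphere 0 1)) : Measurable Ω := by
  refine measurable_of_continuousOn_compl_singleton 0 ?_
  have h1 : ContinuousOn (fun x : EuclideanSpace ℝ (Fin n) => ‖x‖⁻¹ • x) {0}ᶜ :=
    (continuousOn_id.norm.inv₀ fun x hx => norm_ne_zero_iff.2 hx).smul continuousOn_id
  exact (hc.comp h1 fun x hx => inv_norm_smul_mem_sphere hx).congr fun x hx => h.eq_normalize hx

lemma MemLip.le_lipNorm (hn : 1 ≤ n) {β : ℝ} {b : EuclideanSpace ℝ (Fin n) → ℝ} (hb : MemLip β b) :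
    0 ≤ lipNorm β b ∧ ∀ x y, |b x - b y| ≤ lipNorm β b * dist x y ^ β := by
  have : Nonempty (Fin n) := ⟨⟨0, hn⟩⟩
  refine ⟨Real.sInf_nonneg fun C hC => ?_, fun x y => ?_⟩
  · obtain ⟨x, y, hxy⟩ := exists_pair_ne (EuclideanSpace ℝ (Fin n))
    have h := (abs_nonneg _).trans (hC x y)
    exact nonneg_of_mul_nonneg_left h (Real.rpow_pos_of_pos (dist_pos.2 hxy) β)
  · rcases (Real.rpow_nonneg dist_nonneg β : 0 ≤ dist x y ^ β).eq_or_lt with h0 | h0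
    · obtain ⟨C, hC⟩ := hb
      simpa [← h0] using hC x y
    · rw [← div_le_iff₀ h0]
      exact le_csInf hb fun C hC => (div_le_iff₀ h0).2 (hC x y)

lemma MemLip.continuous (hn : 1 ≤ n) {β : ℝ} (hβ : 0 < β) {b : EuclideanSpace ℝ (Fin n) → ℝ}
    (hb : MemLip β b) : Continuous b := by
  obtain ⟨h0, h⟩ := hb.le_lipNorm hn
  have : HolderWith (lipNorm β b).toNNReal β.toNNReal b := fun x y => by
    rw [edist_dist, edist_dist, Real.coe_toNNReal _ hβ.le, Real.dist_eq,
      ENNReal.ofReal_rpow_of_nonneg dist_nonneg hβ.le]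
    exact (ENNReal.ofReal_le_ofReal (h x y)).trans_eq (ENNReal.ofReal_mul h0)
  exact this.continuous (by simpa using hβ)

/-- Pointwise domination of the commutator by a Riesz potential. -/
lemma enorm_commutatorOp_le {α β M ℓ : ℝ} (hβ : 0 < β) (hαn : α < n)
    {Ω b f : EuclideanSpace ℝ (Fin n) → ℝ} (hΩ : Measurable Ω) (hM0 : 0 ≤ M)
    (hM : ∀ x, x ≠ 0 → |Ω x| ≤ M) (hb : Measurable b) (hℓ0 : 0 ≤ ℓ)
    (hℓ : ∀ x y, |b x - b y| ≤ ℓ * dist x y ^ β) (hf : Measurable f)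
    {x : EuclideanSpace ℝ (Fin n)} (h1 : rieszPotential volume α (fun y => ‖f y‖ₑ) x < ⊤)
    (h2 : rieszPotential volume (α + β) (fun y => ‖f y‖ₑ) x < ⊤) :
    ‖commutatorOp Ω α b f x‖ₑ ≤
      ENNReal.ofReal (M * ℓ) * rieszPotential volume (α + β) (fun y => ‖f y‖ₑ) x := by
  set F : EuclideanSpace ℝ (Fin n) → ℝ := fun y => Ω (x - y) * ‖x - y‖ ^ (α - n) * f y with hF
  have hFb : ∀ y, ‖F y‖ₑ ≤ ENNReal.ofReal M * (‖x - y‖ₑ ^ (α - n) * ‖f y‖ₑ) := by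
    intro y
    rcases eq_or_ne (x - y) 0 with hy | hy
    · simp [hF, hy, Real.zero_rpow (sub_ne_zero.2 hαn.ne)]
    · rw [hF, enorm_mul, enorm_mul, mul_assoc,
        Real.enorm_of_nonneg (Real.rpow_nonneg (norm_nonneg (x - y)) _),
        ← ENNReal.ofReal_rpow_of_pos (by positivity), ofReal_norm]
      gcongr
      rw [Real.enorm_eq_ofReal_abs]
      exact ENNReal.ofReal_le_ofReal (hM _ hy)
  have hFm : Measurable F := by fun_prop
  have hFi : Integrable F := by
    refine ⟨hFm.aestronglyMeasurable, ?_⟩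
    rw [hasFiniteIntegral_iff_enorm]
    refine (lintegral_mono hFb).trans_lt ?_
    rw [lintegral_const_mul _ (by fun_prop)]
    rw [rieszPotential, finrank_euclideanSpace_fin] at h1
    exact ENNReal.mul_lt_top (by simp) h1
  have hGb : ∀ y, ‖(b x - b y) * F y‖ₑ ≤
      ENNReal.ofReal (M * ℓ) * (‖x - y‖ₑ ^ (α + β - n) * ‖f y‖ₑ) := by
    intro y
    rcases eq_or_ne (x - y) 0 with hy | hy
    · simp [sub_eq_zero.1 hy]
    · have e1 : ‖b x - b y‖ₑ ≤ ENNReal.ofReal ℓ * ‖x - y‖ₑ ^ β := by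
        rw [Real.enorm_eq_ofReal_abs, ← ofReal_norm, ENNReal.ofReal_rpow_of_nonneg (norm_nonneg _)
          hβ.le, ← ENNReal.ofReal_mul hℓ0, ← dist_eq_norm]
        exact ENNReal.ofReal_le_ofReal (hℓ x y)
      have e2 : ‖x - y‖ₑ ^ (α + β - n) = ‖x - y‖ₑ ^ β * ‖x - y‖ₑ ^ (α - n) := by
        rw [← ENNReal.rpow_add _ _ (by simpa using hy) (by simp)]
        congr 1; ring
      rw [enorm_mul, e2, ENNReal.ofReal_mul hM0]
      calc _ ≤ (ENNReal.ofReal ℓ * ‖x - y‖ₑ ^ β) *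
            (ENNReal.ofReal M * (‖x - y‖ₑ ^ (α - n) * ‖f y‖ₑ)) := mul_le_mul' e1 (hFb y)
        _ = _ := by ring
  have hGl : ∫⁻ y, ‖(b x - b y) * F y‖ₑ ≤
      ENNReal.ofReal (M * ℓ) * rieszPotential volume (α + β) (fun y => ‖f y‖ₑ) x := by
    rw [rieszPotential, finrank_euclideanSpace_fin, ← lintegral_const_mul _ (by fun_prop)]
    exact lintegral_mono hGb
  have hGi : Integrable fun y => (b x - b y) * F y := by
    refine ⟨by fun_prop, ?_⟩
    rw [hasFiniteIntegral_iff_enorm]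
    exact hGl.trans_lt (ENNReal.mul_lt_top (by simp) h2)
  have hcomm : commutatorOp Ω α b f x = ∫ y, (b x - b y) * F y := by
    have e1 : fracInt Ω α (fun y => b y * f y) x = ∫ y, (b x * F y - (b x - b y) * F y) :=
      integral_congr_ae (.of_forall fun y => by simp only [hF]; ring)
    rw [commutatorOp, e1, integral_sub (hFi.const_mul _) hGi, integral_const_mul]
    exact sub_sub_cancel _ _
  rw [hcomm]
  exact (enorm_integral_le_lintegral_enorm _).trans hGl

lemma sliceNormE_mono_ae {p q t : ℝ} (hp : 0 < p) (hq : 0 < q)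
    {g g' : EuclideanSpace ℝ (Fin n) → ℝ≥0∞} (h : ∀ᵐ x, g x ≤ g' x) :
    sliceNormE p q t g ≤ sliceNormE p q t g' := by
  unfold sliceNormE
  gcongr ?_ ^ _
  refine lintegral_mono fun x => ?_
  gcongr ?_ ^ _
  refine mul_le_mul_right (lintegral_mono_ae (ae_restrict_of_ae ?_)) _
  filter_upwards [h] with y hy
  gcongr

lemma sliceNormE_const_mul {p q t : ℝ} (hp : 0 < p) (hq : 0 < q) {c : ℝ≥0∞} (hc : c ≠ ⊤)
    (g : EuclideanSpace ℝ (Fin n) → ℝ≥0∞) :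
    sliceNormE p q t (fun x => c * g x) = c * sliceNormE p q t g := by
  have h1 : ∀ x, cubeMean p t (fun y => c * g y) x = c * cubeMean p t g x := fun x => by
    simp only [cubeMean, ENNReal.mul_rpow_of_nonneg _ _ hp.le]
    rw [lintegral_const_mul' _ _ (ENNReal.rpow_ne_top_of_nonneg hp.le hc), mul_left_comm,
      ENNReal.mul_rpow_of_nonneg _ _ (by positivity), ← ENNReal.rpow_mul,
      mul_one_div_cancel hp.ne', ENNReal.rpow_one]
  simp only [sliceNormE_eq, h1, ENNReal.mul_rpow_of_nonneg _ _ hq.le]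
  rw [lintegral_const_mul' _ _ (ENNReal.rpow_ne_top_of_nonneg hq.le hc),
    ENNReal.mul_rpow_of_nonneg _ _ (by positivity), ← ENNReal.rpow_mul,
    mul_one_div_cancel hq.ne', ENNReal.rpow_one]

lemma ae_rieszPotential_lt_top (hn : 1 ≤ n) {γ p q t : ℝ} (hγ0 : 0 < γ) (hγ : γ < n) (hp : 1 < p)
    (hq : 1 < q) (hγp : γ / n < 1 / p) (hγq : γ / n < 1 / q) (ht : 0 < t)
    {g : EuclideanSpace ℝ (Fin n) → ℝ≥0∞} (hg : Measurable g) (h : sliceNormE p q t g ≠ ⊤) :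
    ∀ᵐ x, rieszPotential volume γ g x < ⊤ := by
  have hn0 : (0 : ℝ) < n := by exact_mod_cast hn
  have hexp : ∀ a : ℝ, 1 < a → γ / n < 1 / a → 1 < (1 / a - γ / n)⁻¹ := fun a ha h1 => by
    have : 0 < γ / n := by positivity
    have : 1 / a < 1 := (div_lt_one (by linarith)).2 ha
    exact (one_lt_inv₀ (by linarith)).2 (by linarith)
  obtain ⟨C, hC, hC'⟩ := exists_sliceNormE_rieszPotential_le hn hγ0 hγ hp (hexp p hp hγp) hq
    (hexp q hq hγq) (by rw [one_div, one_div, inv_inv]; ring)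
    (by rw [one_div, one_div, inv_inv]; ring)
  exact ae_lt_top_of_sliceNormE_ne_top (zero_lt_one.trans (hexp p hp hγp))
    (zero_lt_one.trans (hexp q hq hγq)) ht (measurable_rieszPotential volume γ hg)
    ((hC' t g ht hg).trans_lt (ENNReal.mul_lt_top hC.lt_top h.lt_top)).ne

end Slice

theorem statement2 (n : ℕ) (hn : 1 ≤ n) (α β : ℝ) (hβ0 : 0 < β) (hβ1 : β < 1)
    (hα0 : 0 < α) (hαn : α < n) (hαβ : α + β < n)
    (p q r s : ℝ) (hp1 : 1 < p) (hpr : p < r) (hq1 : 1 < q) (hqs : q < s)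
    (hpr' : (α + β) / n = 1 / p - 1 / r) (hqs' : (α + β) / n = 1 / q - 1 / s)
    (Ω : EuclideanSpace ℝ (Fin n) → ℝ) (hhom : HomogZero Ω) (hmean : MeanZeroOnSphere Ω)
    (L : NNReal) (hlip : LipschitzOnWith L Ω (sphere (0 : EuclideanSpace ℝ (Fin n)) 1)) :
    ∃ C > (0 : ℝ), ∀ b : EuclideanSpace ℝ (Fin n) → ℝ, MemLip β b →
      ∀ t : ℝ, 0 < t → ∀ f : EuclideanSpace ℝ (Fin n) → ℝ, MemSlice p q t f →
        sliceNorm r s t (commutatorOp Ω α b f) ≤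
          ENNReal.ofReal (C * lipNorm β b) * sliceNorm p q t f := by
  have hn0 : (0 : ℝ) < n := by exact_mod_cast hn
  have hc := hlip.continuousOn
  obtain ⟨M, hM0, hM⟩ := hhom.exists_bound hc
  have hr : 1 < r := hp1.trans hpr
  have hs : 1 < s := hq1.trans hqs
  obtain ⟨C, hC, hC'⟩ := exists_sliceNormE_rieszPotential_le hn (add_pos hα0 hβ0) hαβ hp1 hr hq1 hs
    hpr' hqs'
  refine ⟨M * C.toReal + 1, by positivity, fun b hb t ht f ⟨hf, hfin⟩ => ?_⟩
  obtain ⟨hℓ0, hℓ⟩ := hb.le_lipNorm hn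
  have hr1 : 0 < 1 / r := by positivity
  have hs1 : 0 < 1 / s := by positivity
  have hlt : α / n < (α + β) / n := by gcongr; linarith
  unfold sliceNorm at hfin ⊢
  simp only [← Real.enorm_eq_ofReal_abs] at hfin ⊢
  have hfm : Measurable fun y => ‖f y‖ₑ := hf.enorm
  have h1 := ae_rieszPotential_lt_top hn hα0 hαn hp1 hq1 (by linarith) (by linarith) ht hfm hfin
  have h2 := ae_rieszPotential_lt_top hn (add_pos hα0 hβ0) hαβ hp1 hq1 (by linarith) (by linarith)
    ht hfm hfin
  calc _ ≤ sliceNormE r s t fun x => ENNReal.ofReal (M * lipNorm β b) *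
        rieszPotential volume (α + β) (fun y => ‖f y‖ₑ) x := by
        refine sliceNormE_mono_ae (by linarith) (by linarith) ?_
        filter_upwards [h1, h2] with x hx1 hx2
        exact enorm_commutatorOp_le hβ0 hαn (hhom.measurable hc) hM0 hM
          (hb.continuous hn hβ0).measurable hℓ0 hℓ hf hx1 hx2
    _ ≤ ENNReal.ofReal (M * lipNorm β b) * (C * sliceNormE p q t fun y => ‖f y‖ₑ) := by
        rw [sliceNormE_const_mul (by linarith) (by linarith) (by simp)]
        gcongr
        exact hC' t _ ht hfm
    _ = ENNReal.ofReal (M * C.toReal * lipNorm β b) * sliceNormE p q t fun y => ‖f y‖ₑ := by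
        rw [mul_right_comm M, ENNReal.ofReal_mul (p := M * lipNorm β b) (by positivity),
          ENNReal.ofReal_toReal hC, mul_assoc]
    _ ≤ _ := by
        gcongr
        linarith

end
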